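/- Let 1 ≤ k < n, S = {1,…,k}, and α = k/n. Let T be a tree chosen uniformly at random among all trees on vertex set {1,…,n} in which S is an independent set, and let N be the number of vertices in S^c = {k+1,…,n} that have no neighbor in S. Then for all 0 < s < 1, P(N < (1−s)·E[N] − 1) ≤ exp(−s²·n·(1−α)²·e^{−α/(1−α)}/2). -/

import Mathlib

open scoped Classical

/-- `NStree n k G` : the number of vertices `x ∈ Sᶜ` with no neighbor in
`S = {x | (x : ℕ) < k}` in the graph `G`. -/
noncomputable def NStree (n k : ℕ) (G : SimpleGraph (Fin n)) : ℕ :=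
  Set.ncard {x : Fin n | k ≤ (x : ℕ) ∧ ∀ s : Fin n, (s : ℕ) < k → ¬ G.Adj x s}

/-- The finite set of trees on vertex set `Fin n` in which
`S = {x | (x : ℕ) < k}` is an independent set. -/
noncomputable def indepTrees (n k : ℕ) : Finset (SimpleGraph (Fin n)) :=
  Set.Finite.toFinset (Set.toFinite {G : SimpleGraph (Fin n) | G.IsTree ∧
    ∀ x y : Fin n, (x : ℕ) < k → (y : ℕ) < k → ¬ G.Adj x y})

/-- Expectation of `NStree n k` under the uniform distribution on `indepTrees n k`. -/
noncomputable def treeEN (n k : ℕ) : ℝ :=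
  (∑ G ∈ indepTrees n k, (NStree n k G : ℝ)) / (indepTrees n k).card

/-- Probability of an event under the uniform distribution on `indepTrees n k`. -/
noncomputable def treePr (n k : ℕ) (P : SimpleGraph (Fin n) → Prop) : ℝ :=
  (((indepTrees n k).filter P).card : ℝ) / (indepTrees n k).card

/-- `f` maps every vertex other than the root `r` to its parent: iterating `f` leads to `r`. -/
def IsParentMap {V : Type*} (r : V) (f : V → V) : Prop :=
  f r = r ∧ ∀ x, ∃ i : ℕ, f^[i] x = r

/-- The graph joining every vertex to its parent. -/
def parentGraph {V : Type*} (f : V → V) : SimpleGraph V :=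
  SimpleGraph.fromRel fun x y => f x = y

section ParentMap

variable {V : Type*} {r : V} {f : V → V}

theorem IsParentMap.iterate_root (hf : IsParentMap r f) (i : ℕ) : f^[i] r = r :=
  Function.iterate_fixed hf.1 i

theorem IsParentMap.eq_root_of_iterate_eq (hf : IsParentMap r f) {x : V} {p : ℕ} (hp : 0 < p)
    (hx : f^[p] x = x) : x = r := by
  obtain ⟨i, hi⟩ := hf.2 x
  have h : f^[p * i] x = x := by
    rw [Function.iterate_mul]
    exact Function.iterate_fixed hx i
  obtain ⟨j, hj⟩ : ∃ j, p * i = j + i := ⟨p * i - i, by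
    have := Nat.le_mul_of_pos_left i hp
    omega⟩
  rw [hj, Function.iterate_add_apply, hi, hf.iterate_root] at h
  exact h.symm

theorem IsParentMap.apply_ne (hf : IsParentMap r f) {x : V} (hx : x ≠ r) : f x ≠ x :=
  fun h => hx (hf.eq_root_of_iterate_eq one_pos h)

theorem IsParentMap.exists_depth (hf : IsParentMap r f) :
    ∃ d : V → ℕ, ∀ x, x ≠ r → d (f x) < d x := by
  refine ⟨fun x => Nat.find (hf.2 x), fun x hx => ?_⟩
  have h := Nat.find_spec (hf.2 x)
  have h0 : Nat.find (hf.2 x) ≠ 0 := by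
    intro h0
    rw [h0] at h
    exact hx h
  obtain ⟨j, hj⟩ := Nat.exists_eq_succ_of_ne_zero h0
  rw [hj, Function.iterate_succ_apply] at h
  have := Nat.find_min' (hf.2 (f x)) h
  show Nat.find (hf.2 (f x)) < Nat.find (hf.2 x)
  omega

theorem IsParentMap.of_depth (hr : f r = r) (d : V → ℕ) (hd : ∀ x, x ≠ r → d (f x) < d x) :
    IsParentMap r f := by
  refine ⟨hr, fun x => ?_⟩
  induction h : d x using Nat.strong_induction_on generalizing x with
  | _ m ih =>
    by_cases hx : x = r
    · exact ⟨0, hx⟩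
    · obtain ⟨i, hi⟩ := ih (d (f x)) (h ▸ hd x hx) (f x) rfl
      exact ⟨i + 1, hi⟩

theorem parentGraph_adj {x y : V} :
    (parentGraph f).Adj x y ↔ x ≠ y ∧ (f x = y ∨ f y = x) := by
  simp [parentGraph]

theorem IsParentMap.connected (hf : IsParentMap r f) : (parentGraph f).Connected := by
  have key : ∀ (i : ℕ) (x : V), (parentGraph f).Reachable x (f^[i] x) := by
    intro i
    induction i with
    | zero => intro x; rfl
    | succ i ih =>
      intro x
      rw [Function.iterate_succ_apply]
      refine SimpleGraph.Reachable.trans ?_ (ih (f x))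
      by_cases h : x = f x
      · rw [← h]
      · exact SimpleGraph.Adj.reachable (parentGraph_adj.2 ⟨h, Or.inl rfl⟩)
  have hr : ∀ x, (parentGraph f).Reachable x r := fun x => by
    obtain ⟨i, hi⟩ := hf.2 x
    exact hi ▸ key i x
  exact (SimpleGraph.connected_iff _).2 ⟨fun x y => (hr x).trans (hr y).symm, ⟨r⟩⟩

theorem IsParentMap.isTree [Finite V] (hf : IsParentMap r f) : (parentGraph f).IsTree := by
  have := Fintype.ofFinite V
  refine SimpleGraph.isTree_iff_connected_and_card.2 ⟨hf.connected, le_antisymm ?_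
    hf.connected.card_vert_le_card_edgeSet_add_one⟩
  let φ : {x : V // x ≠ r} → Sym2 V := fun x => s(x.1, f x.1)
  have hsub : (parentGraph f).edgeSet ⊆ Set.range φ := by
    intro e
    induction e using Sym2.ind with
    | _ x y =>
      intro h
      obtain ⟨hne, h⟩ := parentGraph_adj.1 (SimpleGraph.mem_edgeSet _ |>.1 h)
      rcases h with h | h
      · refine ⟨⟨x, ?_⟩, by simp [φ, h]⟩
        rintro rfl
        exact hne (hf.1.symm.trans h)
      · refine ⟨⟨y, ?_⟩, by simp [φ, h, Sym2.eq_swap]⟩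
        rintro rfl
        exact hne (h.symm.trans hf.1)
  have h1 : Nat.card (parentGraph f).edgeSet ≤ Nat.card {x : V // x ≠ r} :=
    (Nat.card_mono (Set.toFinite _) hsub).trans (Finite.card_range_le φ)
  have h2 : Nat.card {x : V // x ≠ r} + 1 = Nat.card V := by
    have h3 : 0 < Fintype.card V := Fintype.card_pos_iff.2 ⟨r⟩
    rw [Nat.card_eq_fintype_card, Nat.card_eq_fintype_card, Fintype.card_subtype_compl,
      Fintype.card_subtype_eq]
    omega
  omega

theorem IsParentMap.eq_of_parentGraph_eq {g : V → V} (hf : IsParentMap r f)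
    (hg : IsParentMap r g) (h : parentGraph f = parentGraph g) : f = g := by
  by_contra hne
  obtain ⟨x, hx⟩ := Function.ne_iff.1 hne
  have step : ∀ x, f x ≠ g x → f (g x) ≠ g (g x) := by
    intro x hx
    have hxr : x ≠ r := by
      rintro rfl
      exact hx (hf.1.trans hg.1.symm)
    have hadj : (parentGraph f).Adj x (g x) :=
      h ▸ parentGraph_adj.2 ⟨(hg.apply_ne hxr).symm, Or.inl rfl⟩
    have h1 : f (g x) = x := (parentGraph_adj.1 hadj).2.resolve_left hx
    rw [h1]
    intro h2
    exact hxr (hg.eq_root_of_iterate_eq two_pos h2.symm)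
  have all : ∀ i, f (g^[i] x) ≠ g (g^[i] x) := by
    intro i
    induction i with
    | zero => exact hx
    | succ i ih =>
      rw [Function.iterate_succ_apply']
      exact step _ ih
  obtain ⟨i, hi⟩ := hg.2 x
  exact all i (by rw [hi, hf.1, hg.1])

theorem SimpleGraph.IsTree.exists_parentMap {G : SimpleGraph V} (hG : G.IsTree) (r : V) :
    ∃ f, IsParentMap r f ∧ parentGraph f = G := by
  have hc := hG.connected
  have key : ∀ x, ∃ y, (x = r → y = r) ∧ (x ≠ r → G.Adj x y ∧ G.dist y r < G.dist x r) := by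
    intro x
    by_cases hx : x = r
    · exact ⟨r, fun _ => rfl, fun h => absurd hx h⟩
    · obtain ⟨p, hp⟩ := hc.exists_walk_length_eq_dist x r
      cases p with
      | nil => exact absurd rfl hx
      | cons hadj q =>
        refine ⟨_, fun h => absurd h hx, fun _ => ⟨hadj, ?_⟩⟩
        have := SimpleGraph.dist_le q
        rw [SimpleGraph.Walk.length_cons] at hp
        omega
  choose f hf using key
  have hpf : IsParentMap r f :=
    .of_depth ((hf r).1 rfl) (fun x => G.dist x r) fun x hx => ((hf x).2 hx).2
  have hle : parentGraph f ≤ G := by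
    intro x y hxy
    obtain ⟨hne, h | h⟩ := parentGraph_adj.1 hxy
    · have hx : x ≠ r := by
        rintro rfl
        exact hne (hpf.1.symm.trans h)
      exact h ▸ ((hf x).2 hx).1
    · have hy : y ≠ r := by
        rintro rfl
        exact hne (h.symm.trans hpf.1)
      exact h ▸ ((hf y).2 hy).1.symm
  exact ⟨f, hpf, le_antisymm hle
    ((SimpleGraph.isTree_iff_minimal_connected.1 hG).2 hpf.connected hle)⟩

theorem IsParentMap.parentGraph_le_iff (hf : IsParentMap r f) {H : SimpleGraph V} :
    parentGraph f ≤ H ↔ ∀ x, x ≠ r → H.Adj x (f x) := by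
  refine ⟨fun h x hx => h (parentGraph_adj.2 ⟨(hf.apply_ne hx).symm, Or.inl rfl⟩),
    fun h x y hxy => ?_⟩
  obtain ⟨hne, rfl | rfl⟩ := parentGraph_adj.1 hxy
  · exact h x fun hx => hne (by rw [hx, hf.1])
  · exact (h y fun hy => hne (by rw [hy, hf.1])).symm

/-- Spanning trees of `H` correspond to parent maps along edges of `H`. -/
theorem card_isTree_le_eq_card_isParentMap [Fintype V] [DecidableEq V] (H : SimpleGraph V) (r : V) :
    (Finset.univ.filter fun G : SimpleGraph V => G.IsTree ∧ G ≤ H).card =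
      (Finset.univ.filter fun f : V → V =>
        IsParentMap r f ∧ ∀ x, x ≠ r → H.Adj x (f x)).card := by
  symm
  refine Finset.card_bij (fun f _ => parentGraph f) ?_ ?_ ?_
  · intro f hf
    simp only [Finset.mem_filter, Finset.mem_univ, true_and] at hf ⊢
    exact ⟨hf.1.isTree, hf.1.parentGraph_le_iff.2 hf.2⟩
  · intro f hf g hg h
    simp only [Finset.mem_filter, Finset.mem_univ, true_and] at hf hg
    exact hf.1.eq_of_parentGraph_eq hg.1 h
  · intro G hG
    simp only [Finset.mem_filter, Finset.mem_univ, true_and] at hG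
    obtain ⟨f, hf, rfl⟩ := hG.1.exists_parentMap r
    exact ⟨f, by simpa using ⟨hf, hf.parentGraph_le_iff.1 hG.2⟩, rfl⟩

end ParentMap

section MatrixTree
open Matrix

variable {V : Type*} [Fintype V] [DecidableEq V]

theorem IsParentMap.det_eq_one {r : V} {f : V → V} (hf : IsParentMap r f) :
    (Matrix.of fun x => if x = r then Pi.single r (1 : ℝ)
      else Pi.single x 1 - Pi.single (f x) 1).det = 1 := by
  obtain ⟨d, hd⟩ := hf.exists_depth
  set M : Matrix V V ℝ := Matrix.of fun x => if x = r then Pi.single r (1 : ℝ)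
      else Pi.single x 1 - Pi.single (f x) 1 with hM
  have happ : ∀ x y, x ≠ y → (x = r ∨ f x ≠ y) → M x y = 0 := by
    intro x y hxy h
    by_cases hx : x = r
    · subst hx
      simp [hM, hxy.symm]
    · have h' := h.resolve_left hx
      simp [hM, hx, hxy.symm, h'.symm]
  have hdiag : ∀ x, M x x = 1 := by
    intro x
    by_cases hx : x = r
    · subst hx
      simp [hM]
    · simp [hM, hx, (hf.apply_ne hx).symm]
  have hne : ∀ x y, x ≠ y → d x ≤ d y → M x y = 0 := by
    intro x y hxy hle
    refine happ x y hxy ?_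
    by_contra! h
    have := hd x h.1
    rw [h.2] at this
    omega
  have hT : BlockTriangular M (fun x => OrderDual.toDual (d x)) := by
    intro x y hxy
    exact hne x y (by rintro rfl; exact lt_irrefl _ hxy) (le_of_lt hxy)
  rw [hT.det]
  refine Finset.prod_eq_one fun a _ => ?_
  have : M.toSquareBlock (fun x => OrderDual.toDual (d x)) a = 1 := by
    ext ⟨x, hx⟩ ⟨y, hy⟩
    rw [toSquareBlock_def, Matrix.of_apply]
    by_cases h : x = y
    · subst h
      simp [hdiag]
    · rw [hne x y h (by rw [← hy] at hx; exact le_of_eq hx), Matrix.one_apply_ne]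
      simpa using h
  rw [this, det_one]

theorem det_eq_zero_of_not_isParentMap {r : V} {f : V → V} (hr : f r = r)
    (hf : ¬ IsParentMap r f) :
    (Matrix.of fun x => if x = r then Pi.single r (1 : ℝ)
      else Pi.single x 1 - Pi.single (f x) 1).det = 0 := by
  rw [← exists_mulVec_eq_zero_iff]
  have hcyc : ∃ x, ∀ i : ℕ, f^[i] x ≠ r := by
    by_contra! h
    exact hf ⟨hr, h⟩
  obtain ⟨z, hz⟩ := hcyc
  let v : V → ℝ := fun x => if ∀ i : ℕ, f^[i] x ≠ r then 1 else 0
  have hvf : ∀ x, x ≠ r → v (f x) = v x := by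
    intro x hx
    refine if_congr ⟨fun h i => ?_, fun h i => h (i + 1)⟩ rfl rfl
    cases i with
    | zero => exact hx
    | succ i => exact h i
  refine ⟨v, fun h => ?_, ?_⟩
  · have := congrFun h z
    rw [Pi.zero_apply, show v z = 1 from if_pos hz] at this
    exact one_ne_zero this
  · ext x
    by_cases hx : x = r
    · subst hx
      have : v x = 0 := if_neg fun h => h 0 rfl
      simp [mulVec, this]
    · simp only [mulVec, Matrix.of_apply, if_neg hx, Pi.zero_apply]
      change (Pi.single x (1 : ℝ) - Pi.single (f x) 1) ⬝ᵥ v = 0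
      simp [sub_dotProduct, hvf x hx]

/-- The matrix-tree theorem: the Laplacian with the row of `r` replaced by a unit row counts
the spanning trees. -/
theorem card_isTree_le_eq_det (H : SimpleGraph V) (r : V) :
    ((Finset.univ.filter fun G : SimpleGraph V => G.IsTree ∧ G ≤ H).card : ℝ) =
      (Matrix.of fun x => if x = r then Pi.single r (1 : ℝ)
        else ∑ y ∈ Finset.univ.filter (H.Adj x), (Pi.single x 1 - Pi.single y 1)).det := by
  rw [card_isTree_le_eq_card_isParentMap H r]
  let A : V → Finset V := fun x => if x = r then {r} else Finset.univ.filter (H.Adj x)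
  let g : V → V → V → ℝ := fun x y => if x = r then Pi.single r (1 : ℝ)
    else Pi.single x 1 - Pi.single y 1
  have h := (detRowAlternating (n := V) (R := ℝ)).toMultilinearMap.map_sum_finset g A
  have h1 : (fun x => ∑ y ∈ A x, g x y) = fun x => if x = r then Pi.single r (1 : ℝ)
        else ∑ y ∈ Finset.univ.filter (H.Adj x), (Pi.single x 1 - Pi.single y 1) := by
    funext x
    by_cases hx : x = r <;> simp [A, g, hx]
  rw [h1] at h
  refine Eq.trans ?_ h.symm
  have h2 : ∀ f ∈ Fintype.piFinset A,
      (detRowAlternating (n := V) (R := ℝ)).toMultilinearMap (fun x => g x (f x)) =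
        if IsParentMap r f then 1 else 0 := by
    intro f hf
    have hr : f r = r := by simpa [A] using Fintype.mem_piFinset.1 hf r
    split_ifs with hp
    · exact hp.det_eq_one
    · exact det_eq_zero_of_not_isParentMap hr hp
  rw [Finset.sum_congr rfl h2, Finset.sum_boole]
  congr 2
  ext f
  simp only [Finset.mem_filter, Finset.mem_univ, true_and, Fintype.mem_piFinset]
  constructor
  · rintro ⟨hf, h⟩
    refine ⟨fun x => ?_, hf⟩
    by_cases hx : x = r
    · simp [A, hx, hf.1]
    · simpa [A, hx] using h x hx
  · rintro ⟨h, hf⟩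
    exact ⟨hf, fun x hx => by simpa [A, hx] using h x⟩

end MatrixTree

section SplitGraph
open Matrix

variable {V : Type*} [DecidableEq V]

/-- The graph on `V` containing all edges except those inside `S` and those between `S` and `A`. -/
def splitGraph (S A : Finset V) : SimpleGraph V where
  Adj x y := x ≠ y ∧ (x ∈ S → y ∉ S ∪ A) ∧ (y ∈ S → x ∉ S ∪ A)
  symm := ⟨fun _ _ h => ⟨h.1.symm, h.2.2, h.2.1⟩⟩
  loopless := ⟨fun _ h => h.1 rfl⟩

variable [Fintype V]

theorem splitGraph_laplacian_row {S A : Finset V} (hSA : Disjoint S A) {r : V} (x z : V)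
    (hx : x ≠ r) :
    (∑ y ∈ Finset.univ.filter ((splitGraph S A).Adj x),
      (Pi.single x (1 : ℝ) - Pi.single y 1 : V → ℝ)) z =
    (if x ∈ S then ((S ∪ A)ᶜ.card : ℝ) else
      if x ∈ A then (A.card : ℝ) + (S ∪ A)ᶜ.card else Fintype.card V) * (if x = z then 1 else 0) -
    ((if x ∉ S then 1 else 0) * (if z ∉ S then 1 else 0) +
      (if x ∈ S.erase r then 1 else 0) * (if z ∉ S ∪ A then 1 else 0) +
      (if x ∉ S ∪ A then 1 else 0) * (if z ∈ S then 1 else 0)) := by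
  have hsum : (∑ y ∈ Finset.univ.filter ((splitGraph S A).Adj x),
      (Pi.single x (1 : ℝ) - Pi.single y 1 : V → ℝ)) z =
      ((Finset.univ.filter ((splitGraph S A).Adj x)).card : ℝ) * (if x = z then 1 else 0) -
        (if (splitGraph S A).Adj x z then 1 else 0) := by
    rw [Finset.sum_apply]
    simp only [Pi.sub_apply, Finset.sum_sub_distrib, Finset.sum_const, nsmul_eq_mul,
      Pi.single_apply, eq_comm (a := z)]
    simp
  rw [hsum]
  have hcompl : Sᶜ.card = A.card + (S ∪ A)ᶜ.card := by
    rw [Finset.card_compl, Finset.card_compl, Finset.card_union_of_disjoint hSA]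
    have := Finset.card_le_univ (S ∪ A)
    rw [Finset.card_union_of_disjoint hSA] at this
    omega
  by_cases hS : x ∈ S
  · have hA : x ∉ A := Finset.disjoint_left.1 hSA hS
    have hf : Finset.univ.filter ((splitGraph S A).Adj x) = (S ∪ A)ᶜ := by
      ext y
      simp only [splitGraph, Finset.mem_filter, Finset.mem_univ, true_and, Finset.mem_compl,
        Finset.mem_union]
      grind
    rw [hf]
    by_cases hz : x = z
    · subst hz
      simp [splitGraph, hS]
    · by_cases hzS : z ∈ S <;> by_cases hzA : z ∈ A <;> simp [splitGraph, hS, hzS, hzA, hz, hx]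
  · by_cases hA : x ∈ A
    · have hf : Finset.univ.filter ((splitGraph S A).Adj x) = Sᶜ.erase x := by
        ext y
        simp only [splitGraph, Finset.mem_filter, Finset.mem_univ, true_and, Finset.mem_compl,
          Finset.mem_union, Finset.mem_erase]
        grind
      have hc : ((Sᶜ.erase x).card : ℝ) = A.card + (S ∪ A)ᶜ.card - 1 := by
        rw [Finset.card_erase_of_mem (by simpa using hS), Nat.cast_sub, hcompl]
        · push_cast; ring
        · exact Finset.card_pos.2 ⟨x, by simpa using hS⟩
      rw [hf, hc]
      by_cases hz : x = z
      · subst hz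
        simp [splitGraph, hS, hA]
      · by_cases hzS : z ∈ S <;> simp [splitGraph, hS, hzS, hA, hz]
    · have hf : Finset.univ.filter ((splitGraph S A).Adj x) = Finset.univ.erase x := by
        ext y
        simp only [splitGraph, Finset.mem_filter, Finset.mem_univ, true_and,
          Finset.mem_union, Finset.mem_erase]
        grind
      have hc : ((Finset.univ.erase x).card : ℝ) = Fintype.card V - 1 := by
        rw [Finset.card_erase_of_mem (Finset.mem_univ x), Nat.cast_sub, Finset.card_univ]
        · push_cast; ring
        · exact Finset.card_pos.2 ⟨x, by simp⟩
      rw [hf, hc]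
      by_cases hz : x = z
      · subst hz
        simp [splitGraph, hS, hA]
      · by_cases hzS : z ∈ S <;> simp [splitGraph, hS, hzS, hA, hz]

theorem prod_three_parts {S A : Finset V} (hSA : Disjoint S A) {r : V} (hr : r ∈ S) (b m n : ℝ) :
    ∏ x, (if x = r then 1 else if x ∈ S then b else if x ∈ A then m else n) =
      b ^ (S.card - 1) * m ^ A.card * n ^ (S ∪ A)ᶜ.card := by
  rw [← Finset.prod_mul_prod_compl (S ∪ A), Finset.prod_union hSA,
    ← Finset.mul_prod_erase S _ hr]
  congr 1
  · congr 1
    · rw [if_pos rfl, one_mul, ← Finset.card_erase_of_mem hr, ← Finset.prod_const]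
      refine Finset.prod_congr rfl fun x hx => ?_
      rw [Finset.mem_erase] at hx
      simp [hx]
    · rw [← Finset.prod_const]
      refine Finset.prod_congr rfl fun x hx => ?_
      have h1 : x ∉ S := Finset.disjoint_right.1 hSA hx
      have h2 : x ≠ r := by rintro rfl; exact h1 hr
      simp [hx, h1, h2]
  · rw [← Finset.prod_const]
    refine Finset.prod_congr rfl fun x hx => ?_
    simp only [Finset.mem_compl, Finset.mem_union, not_or] at hx
    have h2 : x ≠ r := by rintro rfl; exact hx.1 hr
    simp [hx, h2]

theorem sum_three_parts {S A : Finset V} (hSA : Disjoint S A) {r : V} (hr : r ∈ S)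
    (F : V → ℝ) (u v w : ℝ) (hr0 : F r = 0) (hS : ∀ x ∈ S.erase r, F x = u)
    (hA : ∀ x ∈ A, F x = v) (hB : ∀ x ∈ (S ∪ A)ᶜ, F x = w) :
    ∑ x, F x = (S.card - 1) * u + A.card * v + (S ∪ A)ᶜ.card * w := by
  have hc : ((S.erase r).card : ℝ) = S.card - 1 := by
    rw [Finset.card_erase_of_mem hr, Nat.cast_sub (Finset.card_pos.2 ⟨r, hr⟩)]
    simp
  rw [← Finset.sum_add_sum_compl (S ∪ A), Finset.sum_union hSA,
    ← Finset.add_sum_erase S _ hr, hr0, zero_add, Finset.sum_congr rfl hS,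
    Finset.sum_congr rfl hA, Finset.sum_congr rfl hB]
  simp [hc]

set_option maxHeartbeats 1600000 in
theorem splitGraph_det {S A : Finset V} (hSA : Disjoint S A) {r : V} (hr : r ∈ S)
    (hB : (S ∪ A)ᶜ.Nonempty) :
    (Matrix.of fun x => if x = r then Pi.single r (1 : ℝ)
        else ∑ y ∈ Finset.univ.filter ((splitGraph S A).Adj x),
          (Pi.single x 1 - Pi.single y 1)).det *
        (Fintype.card V * (A.card + (S ∪ A)ᶜ.card)) =
      ((S ∪ A)ᶜ.card : ℝ) ^ S.card * (Fintype.card V : ℝ) ^ (S ∪ A)ᶜ.card *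
        ((A.card : ℝ) + (S ∪ A)ᶜ.card) ^ A.card := by
  have hn' : Fintype.card V = S.card + A.card + (S ∪ A)ᶜ.card := by
    rw [Finset.card_compl, ← Finset.card_union_of_disjoint hSA]
    have := Finset.card_le_univ (S ∪ A)
    omega
  have hn : (Fintype.card V : ℝ) = S.card + A.card + (S ∪ A)ᶜ.card := by exact_mod_cast hn'
  have hprod := fun b m n => prod_three_parts hSA hr b m n
  have hbpos : (0 : ℝ) < (S ∪ A)ᶜ.card := by exact_mod_cast Finset.card_pos.2 hB
  have hkpos : (0 : ℝ) < S.card := by exact_mod_cast Finset.card_pos.2 ⟨r, hr⟩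
  have hkpos' : 0 < S.card := Finset.card_pos.2 ⟨r, hr⟩
  have hrow := fun x z => splitGraph_laplacian_row hSA (r := r) x z
  have hsum := fun F => sum_three_parts hSA hr F
  have happos : (0 : ℝ) ≤ A.card := Nat.cast_nonneg _
  generalize hb : ((S ∪ A)ᶜ.card : ℝ) = b at *
  generalize ha : (A.card : ℝ) = a at *
  generalize hk : (S.card : ℝ) = k at *
  generalize hN : (Fintype.card V : ℝ) = n at *
  set D : V → ℝ := fun x => if x = r then 1 else if x ∈ S then b else if x ∈ A then a + b else n
    with hD
  have hmpos : 0 < a + b := by linarith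
  have hnpos : 0 < n := by linarith
  have hD0 : ∀ x, D x ≠ 0 := by
    intro x
    simp only [hD]
    split_ifs
    · exact one_ne_zero
    · exact hbpos.ne'
    · exact hmpos.ne'
    · exact hnpos.ne'
  let U : Matrix V (Fin 3) ℝ := Matrix.of fun x =>
    ![(if x ∉ S then 1 else 0) / D x, (if x ∈ S.erase r then 1 else 0) / D x,
      (if x ∉ S ∪ A then 1 else 0) / D x]
  let W : Matrix (Fin 3) V ℝ := Matrix.of
    ![fun z => if z ∉ S then 1 else 0, fun z => if z ∉ S ∪ A then 1 else 0,
      fun z => if z ∈ S then 1 else 0]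
  have hM : (Matrix.of fun x => if x = r then Pi.single r (1 : ℝ)
        else ∑ y ∈ Finset.univ.filter ((splitGraph S A).Adj x),
          (Pi.single x 1 - Pi.single y 1)) = diagonal D * (1 - U * W) := by
    ext x z
    rw [diagonal_mul, Matrix.sub_apply, Matrix.mul_apply, Fin.sum_univ_three, Matrix.one_apply]
    rw [Matrix.of_apply]
    by_cases hx : x = r
    · subst hx
      simp [U, W, hr, hD, Pi.single_apply, eq_comm]
    · rw [if_neg hx, hrow x z hx]
      have hDx : D x = if x ∈ S then b else if x ∈ A then a + b else n := by
        simp [hD, hx]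
      rw [← hDx]
      have := hD0 x
      simp only [U, W, Matrix.of_apply, Matrix.cons_val_zero, Matrix.cons_val_one,
        Matrix.cons_val]
      field_simp
  have hr' : r ∉ S.erase r := by simp
  have hSf : ∀ x ∈ S.erase r, x ∈ S ∧ D x = b := by
    intro x hx
    rw [Finset.mem_erase] at hx
    simp [hD, hx]
  have hAf : ∀ x ∈ A, x ∉ S ∧ D x = a + b := by
    intro x hx
    have h1 : x ∉ S := Finset.disjoint_right.1 hSA hx
    have h2 : x ≠ r := by rintro rfl; exact h1 hr
    simp [hD, hx, h1, h2]
  have hBf : ∀ x ∈ (S ∪ A)ᶜ, x ∉ S ∧ x ∉ A ∧ D x = n := by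
    intro x hx
    simp only [Finset.mem_compl, Finset.mem_union, not_or] at hx
    have h2 : x ≠ r := by rintro rfl; exact hx.1 hr
    simp [hD, hx, h2]
  have hWU : W * U = !![b / n + a / (a + b), 0, b / n; b / n, 0, b / n; 0, (k - 1) / b, 0] := by
    ext i j
    rw [Matrix.mul_apply]
    fin_cases i <;> fin_cases j <;> simp only [U, W, Matrix.of_apply, Matrix.cons_val_zero,
      Matrix.cons_val_one, Matrix.cons_val, Fin.zero_eta, Fin.mk_one, Fin.reduceFinMk]
    · rw [hsum _ 0 (1 / (a + b)) (1 / n)] <;> grind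
    · rw [hsum _ 0 0 0] <;> grind
    · rw [hsum _ 0 0 (1 / n)] <;> grind
    · rw [hsum _ 0 0 (1 / n)] <;> grind
    · rw [hsum _ 0 0 0] <;> grind
    · rw [hsum _ 0 0 (1 / n)] <;> grind
    · rw [hsum _ 0 0 0] <;> grind
    · rw [hsum _ (1 / b) 0 0] <;> grind
    · rw [hsum _ 0 0 0] <;> grind
  rw [hM, det_mul, det_diagonal, det_one_sub_mul_comm, hWU, hprod]
  have hdet : (1 - !![b / n + a / (a + b), 0, b / n; b / n, 0, b / n; 0, (k - 1) / b, 0]).det =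
      b / (n * (a + b)) := by
    rw [Matrix.det_fin_three]
    simp [Matrix.sub_apply]
    subst hn
    field_simp
    ring
  rw [hdet]
  obtain ⟨j, hj⟩ := Nat.exists_eq_succ_of_ne_zero hkpos'.ne'
  rw [hj, Nat.succ_sub_one, pow_succ]
  field_simp

/-- The number of spanning trees of `splitGraph S A`. -/
theorem card_isTree_le_splitGraph {S A : Finset V} (hSA : Disjoint S A) (hS : S.Nonempty) :
    ((Finset.univ.filter fun G : SimpleGraph V => G.IsTree ∧ G ≤ splitGraph S A).card : ℝ) *
        (Fintype.card V * (A.card + (S ∪ A)ᶜ.card)) =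
      ((S ∪ A)ᶜ.card : ℝ) ^ S.card * (Fintype.card V : ℝ) ^ (S ∪ A)ᶜ.card *
        ((A.card : ℝ) + (S ∪ A)ᶜ.card) ^ A.card := by
  obtain ⟨r, hr⟩ := hS
  rcases (S ∪ A)ᶜ.eq_empty_or_nonempty with hB | hB
  · rw [hB]
    have hk : S.card ≠ 0 := (Finset.card_pos.2 ⟨r, hr⟩).ne'
    rcases A.eq_empty_or_nonempty with rfl | ⟨x, hx⟩
    · simp [hk]
    · have h0 : (Finset.univ.filter fun G : SimpleGraph V =>
          G.IsTree ∧ G ≤ splitGraph S A) = ∅ := by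
        refine Finset.filter_false_of_mem fun G _ hG => ?_
        obtain ⟨f, hf, rfl⟩ := hG.1.exists_parentMap x
        have hrx : r ≠ x := by
          rintro rfl
          exact Finset.disjoint_left.1 hSA hr hx
        have h1 := (hf.parentGraph_le_iff.1 hG.2 r hrx).2.1 hr
        rw [← Finset.mem_compl, hB] at h1
        exact Finset.notMem_empty _ h1
      simp [h0, hk]
  · rw [card_isTree_le_eq_det _ r]
    exact splitGraph_det hSA hr hB

end SplitGraph

section Occupancy

/-- The empty bins when ball `i` is thrown into bin `h i`. -/
def emptyBins {m k : ℕ} (h : Fin k → Fin m) : Finset (Fin m) :=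
  Finset.univ.filter fun z => ∀ i, h i ≠ z

theorem emptyBins_cons {m k : ℕ} (z : Fin m) (h : Fin k → Fin m) :
    emptyBins (Fin.cons z h : Fin (k + 1) → Fin m) = (emptyBins h).erase z := by
  ext w
  simp only [emptyBins, Finset.mem_filter, Finset.mem_univ, true_and, Finset.mem_erase,
    Fin.forall_fin_succ, Fin.cons_zero, Fin.cons_succ]
  rw [ne_comm]

theorem sum_pow_card_erase_le {m : ℕ} (hm : 0 < m) (E : Finset (Fin m)) {c : ℝ} (hc : 0 ≤ c)
    (hc1 : c ≤ 1) :
    ∑ z, c ^ (E.erase z).card ≤ m * (c + (1 - c) / m) ^ E.card := by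
  have hm' : (0 : ℝ) < m := by exact_mod_cast hm
  have hEm : (E.card : ℝ) ≤ m := by
    exact_mod_cast (Finset.card_le_univ E).trans (by simp)
  have hsplit : ∑ z, c ^ (E.erase z).card =
      E.card * c ^ (E.card - 1) + (m - E.card) * c ^ E.card := by
    rw [← Finset.sum_add_sum_compl E]
    congr 1
    · rw [← nsmul_eq_mul, ← Finset.sum_const]
      exact Finset.sum_congr rfl fun z hz => by rw [Finset.card_erase_of_mem hz]
    · have : ((Eᶜ.card : ℕ) : ℝ) = m - E.card := by
        rw [Finset.card_compl, Nat.cast_sub (Finset.card_le_univ E)]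
        simp
      rw [← this, ← nsmul_eq_mul, ← Finset.sum_const]
      refine Finset.sum_congr rfl fun z hz => ?_
      rw [Finset.erase_eq_of_notMem (by simpa using hz)]
  rw [hsplit]
  generalize E.card = e at *
  have hd : 0 ≤ (1 - c) / m := div_nonneg (by linarith) hm'.le
  have key : ∀ e : ℕ, c ^ e + e * c ^ (e - 1) * ((1 - c) / m) ≤ (c + (1 - c) / m) ^ e := by
    intro e
    induction e with
    | zero => simp
    | succ e ih =>
      have hpow : (e : ℝ) * c ^ (e - 1) * c = e * c ^ e := by
        cases e with
        | zero => simp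
        | succ e => rw [Nat.succ_sub_one, pow_succ]; ring
      have h1 : 0 ≤ (e : ℝ) * c ^ (e - 1) := by positivity
      have h2 := mul_le_mul_of_nonneg_right ih (add_nonneg hc hd)
      rw [← pow_succ] at h2
      refine le_trans ?_ h2
      rw [Nat.add_sub_cancel]
      push_cast
      have h3 : 0 ≤ (e : ℝ) * c ^ (e - 1) * ((1 - c) / m) * ((1 - c) / m) := by positivity
      have h4 : (e : ℝ) * c ^ (e - 1) * ((1 - c) / m) * c = e * c ^ e * ((1 - c) / m) := by
        rw [← hpow]; ring
      rw [pow_succ]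
      nlinarith
  rcases e with _ | e
  · simp
  · have h := mul_le_mul_of_nonneg_left (key (e + 1)) hm'.le
    refine le_trans (le_of_eq ?_) h
    rw [Nat.add_sub_cancel, pow_succ]
    field_simp
    ring

theorem sum_pow_card_emptyBins_le {m : ℕ} (hm : 0 < m) (k : ℕ) {c : ℝ} (hc : 0 ≤ c)
    (hc1 : c ≤ 1) :
    ∑ h : Fin k → Fin m, c ^ (emptyBins h).card ≤
      (m : ℝ) ^ k * (1 - (1 - c) * (1 - 1 / m) ^ k) ^ m := by
  have hm' : (1 : ℝ) ≤ m := by exact_mod_cast hm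
  induction k generalizing c with
  | zero => simp [emptyBins]
  | succ k ih =>
    have hc' : 1 - (c + (1 - c) / m) = (1 - c) * (1 - 1 / m) := by ring
    have h1m : (1 : ℝ) / m ≤ 1 := by rw [div_le_one (by linarith)]; exact hm'
    have hd : 0 ≤ (1 - c) / m := div_nonneg (by linarith) (by linarith)
    rw [← (Fin.consEquiv fun _ : Fin (k + 1) => Fin m).sum_comp, Fintype.sum_prod_type_right]
    have hstep : ∀ h : Fin k → Fin m,
        ∑ z, c ^ (emptyBins (Fin.consEquiv (fun _ : Fin (k + 1) => Fin m) (z, h))).card ≤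
          m * (c + (1 - c) / m) ^ (emptyBins h).card := by
      intro h
      refine le_trans (le_of_eq ?_) (sum_pow_card_erase_le hm (emptyBins h) hc hc1)
      refine Finset.sum_congr rfl fun z _ => ?_
      rw [← emptyBins_cons]
      rfl
    refine (Finset.sum_le_sum fun h _ => hstep h).trans ?_
    rw [← Finset.mul_sum]
    have := ih (c := c + (1 - c) / m) (by linarith) (by
      have := mul_nonneg (sub_nonneg.2 hc1) (sub_nonneg.2 h1m)
      linarith)
    refine (mul_le_mul_of_nonneg_left this (by linarith)).trans (le_of_eq ?_)
    rw [hc', pow_succ (m : ℝ) k, pow_succ (1 - 1 / (m : ℝ)) k]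
    ring

theorem sum_pow_card_emptyBins_eq {m : ℕ} (k : ℕ) (t : ℝ) :
    ∑ h : Fin k → Fin m, (1 - t) ^ (emptyBins h).card =
      ∑ A : Finset (Fin m), (-t) ^ A.card * ((m : ℝ) - A.card) ^ k := by
  have hpow : ∀ h : Fin k → Fin m, (1 - t) ^ (emptyBins h).card =
      ∑ A : Finset (Fin m), if A ⊆ emptyBins h then (-t) ^ A.card else 0 := by
    intro h
    rw [← Finset.sum_filter, show (1 - t) = -t + 1 by ring, ← Finset.sum_pow_mul_eq_add_pow]
    refine Finset.sum_congr (by ext; simp) fun A _ => by simp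
  rw [Finset.sum_congr rfl fun h _ => hpow h, Finset.sum_comm]
  refine Finset.sum_congr rfl fun A _ => ?_
  rw [← Finset.sum_filter, Finset.sum_const, nsmul_eq_mul, mul_comm]
  congr 1
  have : (Finset.univ.filter fun h : Fin k → Fin m => A ⊆ emptyBins h) =
      Fintype.piFinset fun _ => Aᶜ := by
    ext h
    simp only [emptyBins, Finset.subset_iff, Finset.mem_filter, Finset.mem_univ, true_and,
      Fintype.mem_piFinset, Finset.mem_compl]
    exact ⟨fun H i hi => H hi i rfl, fun H a ha i hi => H i (hi ▸ ha)⟩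
  rw [this, Fintype.card_piFinset, Finset.prod_const, Finset.card_univ, Fintype.card_fin,
    Finset.card_compl, Nat.cast_pow, Nat.cast_sub (Finset.card_le_univ A), Fintype.card_fin]

theorem sum_powerset_neg_pow_le {V : Type*} (C : Finset V) (hC : 0 < C.card) (k : ℕ) {t : ℝ}
    (ht : 0 ≤ t) (ht1 : t ≤ 1) :
    ∑ A ∈ C.powerset, (-t) ^ A.card * (1 - (A.card : ℝ) / C.card) ^ k ≤
      (1 - t * (1 - 1 / C.card) ^ k) ^ C.card := by
  have hm : (0 : ℝ) < C.card := by exact_mod_cast hC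
  have h1 := sum_pow_card_emptyBins_le hC k (c := 1 - t) (by linarith) (by linarith)
  rw [sum_pow_card_emptyBins_eq, ← Finset.powerset_univ,
    Finset.sum_powerset_apply_card (fun a : ℕ => (-t) ^ a * ((C.card : ℝ) - a) ^ k),
    Finset.card_univ, Fintype.card_fin, sub_sub_cancel] at h1
  rw [Finset.sum_powerset_apply_card (fun a : ℕ => (-t) ^ a * (1 - (a : ℝ) / C.card) ^ k)]
  refine le_of_mul_le_mul_left (le_trans (le_of_eq ?_) h1) (pow_pos hm k)
  rw [Finset.mul_sum]
  refine Finset.sum_congr rfl fun a _ => ?_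
  rw [show (C.card : ℝ) - a = C.card * (1 - a / C.card) by field_simp, mul_pow, nsmul_eq_mul,
    nsmul_eq_mul]
  ring

end Occupancy

section Estimates

theorem exp_neg_le_quadratic {s : ℝ} (hs : 0 ≤ s) : Real.exp (-s) ≤ 1 - s + s ^ 2 / 2 := by
  have h1 := Real.quadratic_le_exp_of_nonneg hs
  have h2 : 0 < 1 - s + s ^ 2 / 2 := by nlinarith [sq_nonneg (s - 1)]
  rw [Real.exp_neg, inv_le_comm₀ (Real.exp_pos s) h2]
  refine le_trans ?_ h1
  rw [inv_le_iff_one_le_mul₀ h2]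
  nlinarith [sq_nonneg (s ^ 2)]

theorem exp_sub_pow_le {m : ℕ} (hm : 0 < m) (k : ℕ) :
    Real.exp (-((k : ℝ) / m)) - (1 - 1 / (m : ℝ)) ^ k ≤ k / (m : ℝ) ^ 2 := by
  have hm' : (1 : ℝ) ≤ m := by exact_mod_cast hm
  have h1m : (1 : ℝ) / m ≤ 1 := by rw [div_le_one (by linarith)]; exact hm'
  have h0m : (0 : ℝ) < 1 / m := by positivity
  have habs := Real.abs_exp_sub_one_sub_id_le (x := -(1 / (m : ℝ)))
    (by rw [abs_neg, abs_of_pos h0m]; exact h1m)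
  have hx : Real.exp (-(1 / (m : ℝ))) ≤ 1 - 1 / m + 1 / (m : ℝ) ^ 2 := by
    have := (abs_le.1 habs).2
    have h2 : (-(1 / (m : ℝ))) ^ 2 = 1 / (m : ℝ) ^ 2 := by ring
    linarith
  have hx1 : Real.exp (-(1 / (m : ℝ))) ≤ 1 := Real.exp_le_one_iff.2 (by linarith)
  have hpow : Real.exp (-((k : ℝ) / m)) = Real.exp (-(1 / (m : ℝ))) ^ k := by
    rw [← Real.exp_nat_mul]
    congr 1
    ring
  rw [hpow]
  clear hpow
  have hx0 := (Real.exp_pos (-(1 / (m : ℝ)))).le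
  generalize Real.exp (-(1 / (m : ℝ))) = x at *
  have hy0 : 0 ≤ 1 - 1 / (m : ℝ) := by linarith
  induction k with
  | zero => simp
  | succ k ih =>
    have hyk : (1 - 1 / (m : ℝ)) ^ k ≤ 1 := pow_le_one₀ hy0 (by linarith)
    have hyk0 : 0 ≤ (1 - 1 / (m : ℝ)) ^ k := pow_nonneg hy0 k
    have hxm := sub_nonneg.2 hx
    have hm2 : (0 : ℝ) < 1 / (m : ℝ) ^ 2 := by positivity
    have hk0 : (0 : ℝ) ≤ k / (m : ℝ) ^ 2 := by positivity
    have e1 : x ^ (k + 1) - (1 - 1 / (m : ℝ)) ^ (k + 1) =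
        x * (x ^ k - (1 - 1 / (m : ℝ)) ^ k) +
          (x - (1 - 1 / (m : ℝ))) * (1 - 1 / (m : ℝ)) ^ k := by ring
    have e2 := mul_le_mul_of_nonneg_left ih hx0
    have e3 := mul_le_mul_of_nonneg_right hx1 hk0
    have e4 : (x - (1 - 1 / (m : ℝ))) * (1 - 1 / (m : ℝ)) ^ k ≤
        1 / (m : ℝ) ^ 2 * (1 - 1 / (m : ℝ)) ^ k :=
      mul_le_mul_of_nonneg_right (by linarith) hyk0
    have e5 := mul_le_mul_of_nonneg_left hyk hm2.le
    have e6 : ((k + 1 : ℕ) : ℝ) / (m : ℝ) ^ 2 = k / (m : ℝ) ^ 2 + 1 / (m : ℝ) ^ 2 := by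
      push_cast
      ring
    rw [e1, e6]
    linarith

end Estimates

section Tail

variable {γ V : Type*} [DecidableEq V] (T : Finset γ) (U : γ → Finset V) (C : Finset V) (k n : ℕ)

/-- The number of members of `T` whose set `U` contains `A`. -/
noncomputable def superCount (A : Finset V) : ℕ := (T.filter fun G => A ⊆ U G).card

variable {T U C k n}

theorem superCount_eq (hC : 0 < C.card) (hn : n = k + C.card)
    (hcount : ∀ A ⊆ C, (superCount T U A : ℝ) * (n * C.card) =
      ((C.card : ℝ) - A.card) ^ k * (n : ℝ) ^ (C.card - A.card) * (C.card : ℝ) ^ A.card)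
    {A : Finset V} (hA : A ⊆ C) :
    (superCount T U A : ℝ) =
      T.card * ((1 - (A.card : ℝ) / C.card) ^ k * ((C.card : ℝ) / n) ^ A.card) := by
  have h0 := hcount ∅ (Finset.empty_subset C)
  have h1 := hcount A hA
  have hT : superCount T U ∅ = T.card := by simp [superCount]
  rw [hT] at h0
  have hle := Finset.card_le_card hA
  have hm : (0 : ℝ) < C.card := by exact_mod_cast hC
  have hn' : (0 : ℝ) < n := by exact_mod_cast (by omega : 0 < n)
  refine mul_right_cancel₀ (mul_pos hn' hm).ne' ?_
  rw [h1, mul_right_comm (T.card : ℝ), h0]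
  simp only [Finset.card_empty, Nat.cast_zero, sub_zero, Nat.sub_zero, pow_zero, mul_one]
  rw [show (C.card : ℝ) - A.card = C.card * (1 - A.card / C.card) by field_simp, mul_pow, div_pow]
  have : (n : ℝ) ^ C.card = (n : ℝ) ^ (C.card - A.card) * (n : ℝ) ^ A.card := by
    rw [← pow_add, Nat.sub_add_cancel hle]
  rw [this]
  field_simp

theorem sum_card_eq_sum_superCount (hU : ∀ G ∈ T, U G ⊆ C) :
    ∑ G ∈ T, ((U G).card : ℝ) = ∑ x ∈ C, (superCount T U {x} : ℝ) := by
  have h : ∀ G ∈ T, ((U G).card : ℝ) = ∑ x ∈ C, if {x} ⊆ U G then 1 else 0 := by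
    intro G hG
    rw [Finset.sum_boole]
    congr 2
    ext x
    simpa using fun hx => hU G hG hx
  rw [Finset.sum_congr rfl h, Finset.sum_comm]
  simp [superCount, Finset.sum_boole]

theorem sum_pow_card_eq_sum_superCount (hU : ∀ G ∈ T, U G ⊆ C) (q : ℝ) :
    ∑ G ∈ T, q ^ (U G).card =
      ∑ A ∈ C.powerset, (q - 1) ^ A.card * (superCount T U A : ℝ) := by
  have h : ∀ G ∈ T, q ^ (U G).card =
      ∑ A ∈ C.powerset, if A ⊆ U G then (q - 1) ^ A.card else 0 := by
    intro G hG
    rw [← Finset.sum_filter]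
    nth_rewrite 1 [show q = (q - 1) + 1 by ring]
    rw [← Finset.sum_pow_mul_eq_add_pow]
    refine Finset.sum_congr ?_ fun A _ => by simp
    ext A
    simpa using fun hA => hA.trans (hU G hG)
  rw [Finset.sum_congr rfl h, Finset.sum_comm]
  refine Finset.sum_congr rfl fun A _ => ?_
  rw [← Finset.sum_filter, Finset.sum_const, nsmul_eq_mul, mul_comm, superCount]

theorem lower_tail_of_superCount (hC : 0 < C.card) (hn : n = k + C.card)
    (hU : ∀ G ∈ T, U G ⊆ C)
    (hcount : ∀ A ⊆ C, (superCount T U A : ℝ) * (n * C.card) =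
      ((C.card : ℝ) - A.card) ^ k * (n : ℝ) ^ (C.card - A.card) * (C.card : ℝ) ^ A.card)
    {s : ℝ} (hs0 : 0 < s) (hs1 : s < 1) :
    ((T.filter fun G => ((U G).card : ℝ) <
        (1 - s) * ((∑ G ∈ T, ((U G).card : ℝ)) / T.card) - 1).card : ℝ) / T.card ≤
      Real.exp (-(s ^ 2 * ((C.card : ℝ) ^ 2 / n * Real.exp (-((k : ℝ) / C.card))) / 2)) := by
  have hm : (0 : ℝ) < C.card := by exact_mod_cast hC
  have hn0 : (0 : ℝ) < n := by exact_mod_cast (by omega : 0 < n)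
  have hmn : (C.card : ℝ) ≤ n := by exact_mod_cast (by omega : C.card ≤ n)
  have hkn : (k : ℝ) ≤ n := by exact_mod_cast (by omega : k ≤ n)
  have hT : (0 : ℝ) < T.card := by
    have h0 := hcount ∅ (Finset.empty_subset C)
    rw [show superCount T U ∅ = T.card by simp [superCount]] at h0
    have h1 : (0 : ℝ) < T.card * (n * C.card) := by
      rw [h0]
      simp only [Finset.card_empty, Nat.cast_zero, sub_zero, Nat.sub_zero, pow_zero, mul_one]
      positivity
    exact pos_of_mul_pos_left h1 (by positivity)
  set ρ : ℝ := (1 - 1 / (C.card : ℝ)) ^ k with hρ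
  have hmean : (∑ G ∈ T, ((U G).card : ℝ)) / T.card = (C.card : ℝ) ^ 2 / n * ρ := by
    rw [sum_card_eq_sum_superCount hU, Finset.sum_congr rfl fun x hx =>
      superCount_eq hC hn hcount (Finset.singleton_subset_iff.2 hx)]
    simp only [Finset.card_singleton, Nat.cast_one, pow_one, Finset.sum_const, nsmul_eq_mul]
    rw [← hρ]
    field_simp
  rw [hmean]
  set μ : ℝ := (C.card : ℝ) ^ 2 / n * ρ with hμ
  have hq0 := Real.exp_pos (-s)
  have hq1 : Real.exp (-s) ≤ 1 := Real.exp_le_one_iff.2 (by linarith)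
  have hmgf : (∑ G ∈ T, Real.exp (-s) ^ (U G).card) ≤
      T.card * Real.exp (-((1 - Real.exp (-s)) * μ)) := by
    rw [sum_pow_card_eq_sum_superCount hU]
    have ht : 0 ≤ (1 - Real.exp (-s)) * (C.card / n) :=
      mul_nonneg (by linarith) (by positivity)
    have hmn1 : (C.card : ℝ) / n ≤ 1 := (div_le_one hn0).2 hmn
    have ht1 : (1 - Real.exp (-s)) * (C.card / n) ≤ 1 :=
      mul_le_one₀ (by linarith) (by positivity) hmn1
    have h1 := sum_powerset_neg_pow_le C hC k ht ht1
    have h2 : ∑ A ∈ C.powerset, (Real.exp (-s) - 1) ^ A.card * (superCount T U A : ℝ) =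
        T.card * ∑ A ∈ C.powerset, (-((1 - Real.exp (-s)) * (C.card / n))) ^ A.card *
          (1 - (A.card : ℝ) / C.card) ^ k := by
      rw [Finset.mul_sum]
      refine Finset.sum_congr rfl fun A hA => ?_
      rw [superCount_eq hC hn hcount (Finset.mem_powerset.1 hA), ← neg_mul, mul_pow, neg_sub]
      ring
    rw [h2]
    refine mul_le_mul_of_nonneg_left (h1.trans ?_) hT.le
    rw [← hρ]
    have h1m : (1 : ℝ) / C.card ≤ 1 := by
      rw [div_le_one hm]
      exact_mod_cast hC
    have hρ0 : 0 ≤ ρ := pow_nonneg (by linarith) k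
    have hρ1 : ρ ≤ 1 := pow_le_one₀ (by linarith) (by
      have : (0 : ℝ) < 1 / C.card := by positivity
      linarith)
    have h3 : 0 ≤ 1 - (1 - Real.exp (-s)) * (C.card / n) * ρ := by
      have := mul_le_one₀ ht1 hρ0 hρ1
      linarith
    refine (pow_le_pow_left₀ h3 (Real.one_sub_le_exp_neg _) _).trans (le_of_eq ?_)
    rw [← Real.exp_nat_mul]
    congr 1
    rw [hμ]
    field_simp
  have hmarkov : ((T.filter fun G => ((U G).card : ℝ) < (1 - s) * μ - 1).card : ℝ) ≤
      Real.exp (s * ((1 - s) * μ - 1)) * ∑ G ∈ T, Real.exp (-s) ^ (U G).card := by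
    rw [← Finset.sum_boole, Finset.mul_sum]
    refine Finset.sum_le_sum fun G _ => ?_
    rw [← Real.exp_nat_mul, ← Real.exp_add]
    split_ifs with h
    · refine Real.one_le_exp ?_
      nlinarith
    · exact (Real.exp_pos _).le
  rw [div_le_iff₀ hT]
  refine (hmarkov.trans (mul_le_mul_of_nonneg_left hmgf (Real.exp_pos _).le)).trans ?_
  rw [mul_left_comm, ← Real.exp_add, mul_comm]
  refine mul_le_mul_of_nonneg_right (Real.exp_le_exp.2 ?_) hT.le
  have hμ0 : 0 ≤ μ := by
    rw [← hmean]
    exact div_nonneg (Finset.sum_nonneg fun G _ => Nat.cast_nonneg _) hT.le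
  have h1 := mul_le_mul_of_nonneg_right (exp_neg_le_quadratic hs0.le) hμ0
  have h2 : (C.card : ℝ) ^ 2 / n * Real.exp (-((k : ℝ) / C.card)) - μ ≤ 1 := by
    rw [hμ, ← mul_sub]
    refine (mul_le_mul_of_nonneg_left (exp_sub_pow_le hC k) (by positivity)).trans ?_
    rw [div_mul_div_comm, div_le_one (by positivity)]
    nlinarith [sq_nonneg (C.card : ℝ)]
  have h3 := mul_le_mul_of_nonneg_left h2 (sq_nonneg s)
  nlinarith

end Tail

/-- The vertices outside `{x | x < k}` without neighbors in that set. -/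
noncomputable def unhitVertices (n k : ℕ) (G : SimpleGraph (Fin n)) : Finset (Fin n) :=
  Finset.univ.filter fun x => k ≤ (x : ℕ) ∧ ∀ s : Fin n, (s : ℕ) < k → ¬ G.Adj x s

theorem NStree_eq_card (n k : ℕ) (G : SimpleGraph (Fin n)) :
    NStree n k G = (unhitVertices n k G).card := by
  rw [NStree, unhitVertices, ← Set.ncard_coe_finset]
  congr 1
  ext x
  simp

theorem superCount_indepTrees {n k : ℕ} (hk : 1 ≤ k) (hkn : k < n) {A C : Finset (Fin n)}
    (hCdef : C = Finset.univ.filter fun x : Fin n => k ≤ (x : ℕ)) (hC : C.card = n - k)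
    (hA : A ⊆ C) :
    (superCount (indepTrees n k) (unhitVertices n k) A : ℝ) * (n * C.card) =
      ((C.card : ℝ) - A.card) ^ k * (n : ℝ) ^ (C.card - A.card) * (C.card : ℝ) ^ A.card := by
  have hCk : ∀ x, x ∈ C ↔ k ≤ (x : ℕ) := by simp [hCdef]
  have hdisj : Disjoint Cᶜ A := by
    rw [Finset.disjoint_left]
    intro x hx hxA
    exact Finset.mem_compl.1 hx (hA hxA)
  have hcard : Cᶜ.card = k := by
    rw [Finset.card_compl, Fintype.card_fin, hC]
    omega
  have hne : Cᶜ.Nonempty := by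
    rw [← Finset.card_pos, hcard]
    exact hk
  have hle := Finset.card_le_card hA
  have hcard' : (Cᶜ ∪ A)ᶜ.card = C.card - A.card := by
    rw [Finset.card_compl, Finset.card_union_of_disjoint hdisj, hcard, Fintype.card_fin]
    omega
  have hfilter : (indepTrees n k).filter (fun G => A ⊆ unhitVertices n k G) =
      Finset.univ.filter fun G : SimpleGraph (Fin n) => G.IsTree ∧ G ≤ splitGraph Cᶜ A := by
    ext G
    simp only [indepTrees, Finset.mem_filter, Set.Finite.mem_toFinset, Set.mem_ofPred_eq,
      Finset.mem_univ, true_and, and_assoc]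
    refine and_congr_right fun _ => ⟨?_, ?_⟩
    · rintro ⟨hind, hsub⟩ x y hxy
      have key : ∀ x y, G.Adj x y → x ∈ Cᶜ → y ∉ Cᶜ ∪ A := by
        intro x y hxy hx hy
        rw [Finset.mem_compl, hCk, not_le] at hx
        rcases Finset.mem_union.1 hy with hy | hy
        · rw [Finset.mem_compl, hCk, not_le] at hy
          exact hind x y hx hy hxy
        · exact (Finset.mem_filter.1 (hsub hy)).2.2 x hx hxy.symm
      exact ⟨hxy.ne, key x y hxy, key y x hxy.symm⟩
    · intro hG
      refine ⟨fun x y hx hy hxy => ?_, fun x hx => ?_⟩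
      · refine (hG hxy).2.1 ?_ (Finset.mem_union_left _ ?_)
        · rwa [Finset.mem_compl, hCk, not_le]
        · rwa [Finset.mem_compl, hCk, not_le]
      · refine Finset.mem_filter.2 ⟨Finset.mem_univ _, (hCk x).1 (hA hx), fun y hy hxy => ?_⟩
        refine (hG hxy).2.2 ?_ (Finset.mem_union_right _ hx)
        rwa [Finset.mem_compl, hCk, not_le]
  have h := card_isTree_le_splitGraph hdisj hne
  rw [superCount, hfilter]
  rw [hcard', hcard, Nat.cast_sub hle, Fintype.card_fin, add_sub_cancel] at h
  exact h

theorem tree_concentration_lower_tail (n k : ℕ) (hk : 1 ≤ k) (hkn : k < n)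
    (α : ℝ) (hα : α = (k : ℝ) / n) (s : ℝ) (hs0 : 0 < s) (hs1 : s < 1) :
    treePr n k (fun G => (NStree n k G : ℝ) < (1 - s) * treeEN n k - 1) ≤
      Real.exp (-(s ^ 2 * n * (1 - α) ^ 2 * Real.exp (-(α / (1 - α))) / 2)) := by
  obtain ⟨C, hCdef⟩ : ∃ C, C = Finset.univ.filter fun x : Fin n => k ≤ (x : ℕ) := ⟨_, rfl⟩
  have hC : C.card = n - k := by
    have h := Fin.card_filter_val_lt (n := n) (m := k)
    have h2 := Finset.card_filter_add_card_filter_not (s := (Finset.univ : Finset (Fin n)))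
      (fun x : Fin n => (x : ℕ) < k)
    simp only [not_lt, Finset.card_univ, Fintype.card_fin] at h2
    rw [hCdef]
    omega
  have h := lower_tail_of_superCount (T := indepTrees n k) (U := unhitVertices n k) (C := C)
    (k := k) (n := n) (by omega) (by omega)
    (fun G _ x hx => by
      rw [hCdef]
      exact Finset.mem_filter.2 ⟨Finset.mem_univ _, (Finset.mem_filter.1 hx).2.1⟩)
    (fun A hA => superCount_indepTrees hk hkn hCdef hC hA) hs0 hs1
  simp only [treePr, treeEN, NStree_eq_card]
  refine h.trans (le_of_eq ?_)
  have hn0 : (n : ℝ) ≠ 0 := by exact_mod_cast (by omega : n ≠ 0)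
  have hm0 : (n : ℝ) - k ≠ 0 := sub_ne_zero.2 (by exact_mod_cast (by omega : n ≠ k))
  have h1 : 1 - α = ((n : ℝ) - k) / n := by
    rw [hα]
    field_simp
  have h2 : α / (1 - α) = k / ((n : ℝ) - k) := by
    rw [h1, hα]
    field_simp
  rw [hC, Nat.cast_sub hkn.le, h2, h1]
  congr 3
  field_simp
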